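/- For every integer n > 1 there exist nonnegative integers x, y, z, w and a prime p such that n = x^2 + y^2 + z^2 + 2w^2 and x + y = p. -/

import Mathlib

/-- The ternary quadratic form `a x² + b y² + c z² + 2 r y z + 2 s x z + 2 t x y` is positive definite
of determinant `1` and represents `n`. -/
def UnimodularTernaryRepresents (n a b c r s t : ℤ) : Prop :=
  0 < a ∧ 0 < a * b - t ^ 2 ∧
    a * b * c + 2 * r * s * t - a * r ^ 2 - b * s ^ 2 - c * t ^ 2 = 1 ∧
    ∃ x y z : ℤ, n = a * x ^ 2 + b * y ^ 2 + c * z ^ 2 + 2 * r * y * z + 2 * s * x * z + 2 * t * x * y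

namespace UnimodularTernaryRepresents

variable {n a b c r s t : ℤ}

theorem add_mul_left_mid (h : UnimodularTernaryRepresents n a b c r s t) (k : ℤ) :
    UnimodularTernaryRepresents n a (b + a * k ^ 2 + 2 * t * k) c (r + s * k) s (t + a * k) := by
  obtain ⟨ha, hD, hdet, x, y, z, hn⟩ := h
  refine ⟨ha, by linear_combination hD, by linear_combination hdet, x - k * y, y, z, ?_⟩
  linear_combination hn

theorem add_mul_left_right (h : UnimodularTernaryRepresents n a b c r s t) (k : ℤ) :
    UnimodularTernaryRepresents n a b (c + a * k ^ 2 + 2 * s * k) (r + t * k) (s + a * k) t := by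
  obtain ⟨ha, hD, hdet, x, y, z, hn⟩ := h
  refine ⟨ha, hD, by linear_combination hdet, x - k * z, y, z, ?_⟩
  linear_combination hn

theorem add_mul_mid_right (h : UnimodularTernaryRepresents n a b c r s t) (k : ℤ) :
    UnimodularTernaryRepresents n a b (c + b * k ^ 2 + 2 * r * k) (r + b * k) (s + t * k) t := by
  obtain ⟨ha, hD, hdet, x, y, z, hn⟩ := h
  refine ⟨ha, hD, by linear_combination hdet, x, y - k * z, z, ?_⟩
  linear_combination hn

theorem mid_pos (h : UnimodularTernaryRepresents n a b c r s t) : 0 < b := by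
  obtain ⟨ha, hD, -⟩ := h
  by_contra hb
  nlinarith [sq_nonneg t, mul_nonneg ha.le (not_lt.mp hb |> neg_nonneg.mpr)]

theorem swap_left_mid (h : UnimodularTernaryRepresents n a b c r s t) :
    UnimodularTernaryRepresents n b a c s r t := by
  have hb := h.mid_pos
  obtain ⟨ha, hD, hdet, x, y, z, hn⟩ := h
  exact ⟨hb, by linear_combination hD, by linear_combination hdet, y, x, z,
    by linear_combination hn⟩

theorem minor_mul_minor (h : UnimodularTernaryRepresents n a b c r s t) :
    (a * b - t ^ 2) * (a * c - s ^ 2) = a + (a * r - s * t) ^ 2 := by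
  linear_combination a * h.2.2.1

theorem swap_mid_right (h : UnimodularTernaryRepresents n a b c r s t) :
    UnimodularTernaryRepresents n a c b r t s := by
  have hD' := h.minor_mul_minor
  obtain ⟨ha, hD, hdet, x, y, z, hn⟩ := h
  refine ⟨ha, ?_, by linear_combination hdet, x, z, y, by linear_combination hn⟩
  exact pos_of_mul_pos_right (hD' ▸ by positivity) hD.le

theorem exists_abs_two_mul_add_mul_le (t : ℤ) {a : ℤ} (ha : 0 < a) :
    ∃ k : ℤ, |2 * (t + a * k)| ≤ a := by
  refine ⟨-((2 * t + a) / (2 * a)), ?_⟩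
  have h1 := Int.mul_ediv_add_emod (2 * t + a) (2 * a)
  have h2 := Int.emod_nonneg (2 * t + a) (by omega : 2 * a ≠ 0)
  have h3 := Int.emod_lt_of_pos (2 * t + a) (by omega : 0 < 2 * a)
  rw [abs_le]
  constructor <;> linarith

theorem exists_reduced (h : UnimodularTernaryRepresents n a b c r s t) :
    ∃ b' c' r' s' t', UnimodularTernaryRepresents n a b' c' r' s' t' ∧
      a * b' - t' ^ 2 = a * b - t ^ 2 ∧ |2 * t'| ≤ a ∧ |2 * s'| ≤ a ∧
      |2 * (a * r' - s' * t')| ≤ a * b - t ^ 2 := by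
  obtain ⟨k, hk⟩ := exists_abs_two_mul_add_mul_le (a * r - s * t) h.2.1
  obtain ⟨l, hl⟩ := exists_abs_two_mul_add_mul_le t h.1
  obtain ⟨m, hm⟩ := exists_abs_two_mul_add_mul_le (s + t * k) h.1
  refine ⟨_, _, _, _, _, ((h.add_mul_mid_right k).add_mul_left_mid l).add_mul_left_right m,
    by ring, hl, hm, ?_⟩
  convert hk using 2
  ring

theorem sum_three_squares_of_minimal (h : UnimodularTernaryRepresents n a b c r s t)
    (hab : a ≤ b) (hbc : a * b - t ^ 2 ≤ a * c - s ^ 2) (ht : |2 * t| ≤ a) (hs : |2 * s| ≤ a)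
    (hr : |2 * (a * r - s * t)| ≤ a * b - t ^ 2) : ∃ u v w : ℤ, n = u ^ 2 + v ^ 2 + w ^ 2 := by
  have hm := h.minor_mul_minor
  obtain ⟨ha, hD, hdet, x, y, z, hn⟩ := h
  have ht2 : 4 * t ^ 2 ≤ a ^ 2 := by nlinarith [sq_le_sq' (abs_le.mp ht).1 (abs_le.mp ht).2]
  set D := a * b - t ^ 2 with hDdef
  set E := a * r - s * t with hE
  have hr2 : 4 * E ^ 2 ≤ D ^ 2 := by nlinarith [sq_le_sq' (abs_le.mp hr).1 (abs_le.mp hr).2]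
  have hDa : 3 * D ^ 2 ≤ 4 * a := by nlinarith
  have haD : 3 * a ^ 2 ≤ 4 * D := by nlinarith
  have ha1 : a = 1 := by
    have hDle : D ≤ a := by nlinarith
    have : a ≤ 1 := by nlinarith
    omega
  subst ha1
  have hD1 : D = 1 := by nlinarith
  rw [abs_le] at ht hs hr
  obtain rfl : t = 0 := by omega
  obtain rfl : s = 0 := by omega
  have hr0 : r = 0 := by omega
  subst hr0
  have hb1 : b = 1 := by linarith
  subst hb1
  have hc1 : c = 1 := by linarith
  subst hc1
  exact ⟨x, y, z, by linear_combination hn⟩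

theorem sum_three_squares (h : UnimodularTernaryRepresents n a b c r s t) :
    ∃ u v w : ℤ, n = u ^ 2 + v ^ 2 + w ^ 2 := by
  obtain ⟨A, hA⟩ : ∃ A : ℕ, (A : ℤ) = a := ⟨a.toNat, Int.toNat_of_nonneg h.1.le⟩
  induction A using Nat.strong_induction_on generalizing a b c r s t with
  | _ A ihA =>
    obtain ⟨D, hD⟩ : ∃ D : ℕ, (D : ℤ) = a * b - t ^ 2 := ⟨_, Int.toNat_of_nonneg h.2.1.le⟩
    induction D using Nat.strong_induction_on generalizing b c r s t with
    | _ D ihD =>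
      obtain ⟨b', c', r', s', t', h', hminor, ht, hs, hr⟩ := h.exists_reduced
      rcases lt_or_ge b' a with hba | hab
      · have hb := h'.mid_pos
        exact ihA b'.toNat (by omega) h'.swap_left_mid (Int.toNat_of_nonneg hb.le)
      rcases lt_or_ge (a * c' - s' ^ 2) (a * b' - t' ^ 2) with hcb | hbc
      · have hc := h'.swap_mid_right.2.1
        exact ihD (a * c' - s' ^ 2).toNat (by omega) h'.swap_mid_right (Int.toNat_of_nonneg hc.le)
      exact h'.sum_three_squares_of_minimal hab hbc ht hs (hminor ▸ hr)

end UnimodularTernaryRepresents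

theorem exists_prime_jacobiSym_eq_one {n : ℕ} (hn : n % 4 = 2) :
    ∃ b p : ℕ, p.Prime ∧ p + 1 = b * n ∧ jacobiSym (-b) p = 1 := by
  obtain ⟨p, hpn, hp, hmod⟩ := Nat.forall_exists_prime_gt_and_modEq n (q := 4 * n) (a := n - 1)
    (by omega) (by
      have h1 : (n - 1).Coprime n := by
        simpa [show n - 1 + 1 = n by omega] using Nat.coprime_self_add_right (m := n - 1) (n := 1)
      have h2 : (n - 1).Coprime 2 := (Nat.coprime_two_right).mpr (Nat.odd_iff.mpr (by omega))
      exact Nat.Coprime.mul_right (Nat.Coprime.pow_right 2 h2) h1)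
  have hle : n - 1 ≤ p := by omega
  obtain ⟨v, hv⟩ := (Nat.modEq_iff_dvd' hle).mp hmod.symm
  have hpb : p + 1 = (4 * v + 1) * n := by
    have : p = 4 * n * v + (n - 1) := by omega
    rw [this, add_assoc, Nat.sub_add_cancel (by omega)]
    ring
  refine ⟨4 * v + 1, p, hp, hpb, ?_⟩
  have hp4 : p % 4 = 1 := by
    have : (p + 1) % 4 = 2 := by rw [hpb, Nat.mul_mod, hn]; omega
    omega
  have hpodd : Odd p := Nat.odd_iff.mpr (by omega)
  rw [jacobiSym.neg _ hpodd, ZMod.χ₄_nat_one_mod_four hp4, one_mul,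
    jacobiSym.quadratic_reciprocity_one_mod_four (by omega) hpodd,
    jacobiSym.mod_left' (a₂ := -1) (?_),
    jacobiSym.at_neg_one (Nat.odd_iff.mpr (by omega)), ZMod.χ₄_nat_one_mod_four (by omega)]
  have : (p : ℤ) = -1 + (4 * v + 1 : ℕ) * n := by
    have : (p : ℤ) + 1 = (4 * v + 1 : ℕ) * n := mod_cast hpb
    linarith
  rw [this, Int.add_mul_emod_self_left]

theorem sum_three_squares_of_mod_four_eq_two {n : ℕ} (hn : n % 4 = 2) :
    ∃ u v w : ℤ, (n : ℤ) = u ^ 2 + v ^ 2 + w ^ 2 := by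
  obtain ⟨b, p, hp, hpb, hJ⟩ := exists_prime_jacobiSym_eq_one hn
  have : Fact p.Prime := ⟨hp⟩
  obtain ⟨y, hy⟩ := ZMod.isSquare_of_jacobiSym_eq_one hJ
  obtain ⟨t, rfl⟩ := ZMod.intCast_surjective y
  have hdvd : (p : ℤ) ∣ b + t ^ 2 := by
    rw [← ZMod.intCast_zmod_eq_zero_iff_dvd]
    push_cast at hy ⊢
    linear_combination -hy
  obtain ⟨a, ha⟩ := hdvd
  have hpb' : (p : ℤ) + 1 = b * n := mod_cast hpb
  have hb : 0 < b := Nat.pos_of_mul_pos_right (b := n) (by omega)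
  have hp0 : (0 : ℤ) < p := mod_cast hp.pos
  have ha0 : 0 < a := by
    refine pos_of_mul_pos_right (a := (p : ℤ)) ?_ hp0.le
    rw [← ha]; positivity
  refine UnimodularTernaryRepresents.sum_three_squares (a := a) (b := p) (c := n) (r := 0) (s := 1)
    (t := t) ⟨ha0, ?_, ?_, 0, 0, 1, by ring⟩
  · have : a * p - t ^ 2 = b := by linarith
    rw [this]; exact_mod_cast hb
  · linear_combination (-(n : ℤ)) * ha - hpb'

theorem exists_sq_add_two_mul_sq_add_four_mul_sq {m : ℕ} (hm : Odd m) :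
    ∃ d z w : ℤ, (m : ℤ) = d ^ 2 + 2 * z ^ 2 + 4 * w ^ 2 := by
  have hm2 : (m : ℤ) % 2 = 1 := by exact_mod_cast Nat.odd_iff.mp hm
  have key : ∀ x y z : ℤ, (2 * m : ℤ) = x ^ 2 + y ^ 2 + z ^ 2 → x % 2 = 1 → y % 2 = 1 →
      z % 2 = 0 → ∃ d z w : ℤ, (m : ℤ) = d ^ 2 + 2 * z ^ 2 + 4 * w ^ 2 := by
    intro x y z h hx hy hz
    obtain ⟨A, hA⟩ : ∃ A, x + y = 2 * A := ⟨(x + y) / 2, by omega⟩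
    obtain ⟨C, rfl⟩ : ∃ C, z = 2 * C := ⟨z / 2, by omega⟩
    obtain rfl : y = 2 * A - x := by omega
    rcases Int.emod_two_eq_zero_or_one A with hA2 | hA2
    · obtain ⟨B, rfl⟩ : ∃ B, A = 2 * B := ⟨A / 2, by omega⟩
      exact ⟨x - 2 * B, C, B, by linarith⟩
    · obtain ⟨B, hB⟩ : ∃ B, x - A = 2 * B := ⟨(x - A) / 2, by omega⟩
      obtain rfl : x = A + 2 * B := by omega
      exact ⟨A, C, B, by linarith⟩
  obtain ⟨x, y, z, h⟩ := sum_three_squares_of_mod_four_eq_two (n := 2 * m)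
    (by have := Nat.odd_iff.mp hm; omega)
  push_cast at h
  have hsq : ∀ x : ℤ, x % 2 = 0 ∧ x ^ 2 % 4 = 0 ∨ x % 2 = 1 ∧ x ^ 2 % 4 = 1 := fun x ↦ by
    rcases Int.even_or_odd' x with ⟨k, rfl | rfl⟩
    · exact .inl ⟨by omega, by ring_nf; omega⟩
    · exact .inr ⟨by omega, by ring_nf; omega⟩
  rcases hsq x with ⟨hx, hx'⟩ | ⟨hx, hx'⟩ <;> rcases hsq y with ⟨hy, hy'⟩ | ⟨hy, hy'⟩ <;>
    rcases hsq z with ⟨hz, hz'⟩ | ⟨hz, hz'⟩ <;> try omega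
  · exact key y z x (by linarith) hy hz hx
  · exact key x z y (by linarith) hx hz hy
  · exact key x y z h hx hy hz

open ArithmeticFunction in
theorem log_factorial_div_eq_sum_vonMangoldt (N k : ℕ) :
    Real.log (N / k).factorial =
      ∑ d ∈ Finset.Ioc 0 N, vonMangoldt d * ((N / d / k : ℕ) : ℝ) := by
  have hlog : ∀ m : ℕ, Real.log m.factorial =
      ∑ d ∈ Finset.Ioc 0 m, vonMangoldt d * ((m / d : ℕ) : ℝ) := by
    intro m
    rw [← sum_Ioc_mul_zeta_eq_sum, vonMangoldt_mul_zeta]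
    induction m with
    | zero => simp
    | succ m ih =>
      rw [Finset.sum_Ioc_succ_top (by omega), ← ih, Nat.factorial_succ, Nat.cast_mul,
        Real.log_mul (by positivity) (by positivity), log_apply, add_comm]
  rw [hlog]
  refine (Finset.sum_subset (Finset.Ioc_subset_Ioc_right (Nat.div_le_self N k)) ?_).trans ?_
  · intro d _ hd
    have : N / k / d = 0 := by
      simp only [Finset.mem_Ioc] at *
      exact Nat.div_eq_of_lt (by omega)
    simp [this]
  · refine Finset.sum_congr rfl fun d _ ↦ ?_
    rw [Nat.div_div_eq_div_mul, Nat.div_div_eq_div_mul, mul_comm k]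

/-- The logarithm of Chebyshev's quotient `N! ⌊N/30⌋! / (⌊N/2⌋! ⌊N/3⌋! ⌊N/5⌋!)`. -/
noncomputable def logChebyshevQuotient (N : ℕ) : ℝ :=
  Real.log (N / 1).factorial + Real.log (N / 30).factorial - Real.log (N / 2).factorial -
    Real.log (N / 3).factorial - Real.log (N / 5).factorial

open ArithmeticFunction in
theorem logChebyshevQuotient_eq_sum (N : ℕ) :
    logChebyshevQuotient N = ∑ d ∈ Finset.Ioc 0 N, vonMangoldt d *
      (((N / d / 1 : ℕ) : ℝ) + ((N / d / 30 : ℕ) : ℝ) - ((N / d / 2 : ℕ) : ℝ) -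
        ((N / d / 3 : ℕ) : ℝ) - ((N / d / 5 : ℕ) : ℝ)) := by
  simp only [logChebyshevQuotient, log_factorial_div_eq_sum_vonMangoldt, mul_sub, mul_add,
    Finset.sum_sub_distrib, Finset.sum_add_distrib]

theorem logChebyshevQuotient_le_psi (N : ℕ) : logChebyshevQuotient N ≤ Chebyshev.psi N := by
  rw [logChebyshevQuotient_eq_sum, Chebyshev.psi, Nat.floor_natCast]
  refine Finset.sum_le_sum fun d _ ↦ mul_le_of_le_one_right
    ArithmeticFunction.vonMangoldt_nonneg ?_
  have : N / d / 1 + N / d / 30 ≤ 1 + N / d / 2 + N / d / 3 + N / d / 5 := by omega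
  have : (((N / d / 1 + N / d / 30 : ℕ)) : ℝ) ≤ (1 + N / d / 2 + N / d / 3 + N / d / 5 : ℕ) :=
    mod_cast this
  push_cast at this ⊢
  linarith

open ArithmeticFunction in
theorem psi_sub_psi_div_six_le (N : ℕ) :
    Chebyshev.psi N - Chebyshev.psi (N / 6 : ℕ) ≤ logChebyshevQuotient N := by
  have hdiv : Chebyshev.psi (N / 6 : ℕ) =
      ∑ d ∈ Finset.Ioc 0 N, if d ≤ N / 6 then vonMangoldt d else 0 := by
    rw [Chebyshev.psi, Nat.floor_natCast, ← Finset.sum_filter]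
    refine Finset.sum_congr ?_ fun _ _ ↦ rfl
    ext d
    simp only [Finset.mem_Ioc, Finset.mem_filter]
    omega
  rw [logChebyshevQuotient_eq_sum, hdiv, Chebyshev.psi, Nat.floor_natCast,
    ← Finset.sum_sub_distrib]
  refine Finset.sum_le_sum fun d hd ↦ ?_
  rw [Finset.mem_Ioc] at hd
  split_ifs with hd6
  · rw [sub_self]
    refine mul_nonneg vonMangoldt_nonneg ?_
    have : N / d / 2 + N / d / 3 + N / d / 5 ≤ N / d / 1 + N / d / 30 := by omega
    have : ((N / d / 2 + N / d / 3 + N / d / 5 : ℕ) : ℝ) ≤ (N / d / 1 + N / d / 30 : ℕ) :=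
      mod_cast this
    push_cast at this ⊢
    linarith
  · rw [sub_zero]
    refine le_mul_of_one_le_right vonMangoldt_nonneg ?_
    have h1 : 1 ≤ N / d := (Nat.one_le_div_iff hd.1).mpr hd.2
    have h6 : N / d < 6 := (Nat.div_lt_iff_lt_mul hd.1).mpr (by omega)
    have : 1 + N / d / 2 + N / d / 3 + N / d / 5 ≤ N / d / 1 + N / d / 30 := by omega
    have : ((1 + N / d / 2 + N / d / 3 + N / d / 5 : ℕ) : ℝ) ≤ (N / d / 1 + N / d / 30 : ℕ) :=
      mod_cast this
    push_cast at this ⊢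
    linarith

theorem mul_log_sub_monotone {x y : ℝ} (hx : 1 ≤ x) (hxy : x ≤ y) :
    x * Real.log x - x ≤ y * Real.log y - y := by
  have h := Real.log_le_sub_one_of_pos (show 0 < x / y from div_pos (by linarith) (by linarith))
  have hx0 : 0 < x := by linarith
  have hy : 0 < y := by linarith
  rw [Real.log_div hx0.ne' hy.ne'] at h
  have := Real.log_nonneg hx
  have h2 : y * (Real.log x - Real.log y) ≤ x - y := by
    calc _ ≤ y * (x / y - 1) := by gcongr
      _ = _ := by field_simp
  nlinarith

theorem log_factorial_le {n : ℕ} (hn : n ≠ 0) :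
    Real.log n.factorial ≤ n * Real.log n - n + Real.log n + 1 := by
  induction n, Nat.one_le_iff_ne_zero.mpr hn using Nat.le_induction with
  | base => simp
  | succ n hn1 ih =>
    have hn0 : (0 : ℝ) < n := Nat.cast_pos.mpr hn1
    have h := Real.log_le_sub_one_of_pos (show 0 < (n : ℝ) / (n + 1) by positivity)
    rw [Real.log_div (by positivity) (by positivity)] at h
    have h2 : (n + 1) * (Real.log n - Real.log (n + 1)) ≤ -1 := by
      calc _ ≤ ((n : ℝ) + 1) * (n / (n + 1) - 1) := by gcongr
        _ = _ := by field_simp; ring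
    rw [Nat.factorial_succ, Nat.cast_mul, Real.log_mul (by positivity) (by positivity)]
    have := ih (by omega)
    push_cast
    linarith

theorem log_factorial_floor_le {x : ℝ} (hx : 1 ≤ x) :
    Real.log ⌊x⌋₊.factorial ≤ x * Real.log x - x + Real.log x + 1 := by
  have h1 : 1 ≤ ⌊x⌋₊ := Nat.one_le_floor_iff _ |>.mpr hx
  have h1' : (1 : ℝ) ≤ ⌊x⌋₊ := mod_cast h1
  have hle := Nat.floor_le (show 0 ≤ x by linarith)
  linarith [log_factorial_le (n := ⌊x⌋₊) (by omega), mul_log_sub_monotone h1' hle,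
    Real.log_le_log (by linarith) hle]

theorem le_log_factorial_floor {x : ℝ} (hx : 1 ≤ x) :
    x * Real.log x - x - Real.log (x + 1) ≤ Real.log ⌊x⌋₊.factorial := by
  have hlt := Nat.lt_floor_add_one x
  have hle := Nat.floor_le (show 0 ≤ x by linarith)
  have h := Stirling.le_log_factorial_stirling (n := ⌊x⌋₊ + 1) (by omega)
  rw [Nat.factorial_succ, Nat.cast_mul,
    Real.log_mul (x := ((_ : ℕ) : ℝ)) (by positivity) (by positivity)] at h
  push_cast at h
  have h1 := mul_log_sub_monotone hx hlt.le
  have h2 := Real.log_le_log (by positivity) (show (⌊x⌋₊ : ℝ) + 1 ≤ x + 1 by linarith)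
  have h3 : 0 ≤ Real.log (2 * Real.pi) := Real.log_nonneg (by linarith [Real.pi_gt_three])
  have h4 : 0 ≤ Real.log ((⌊x⌋₊ : ℝ) + 1) := Real.log_nonneg (by linarith)
  linarith

theorem log_factorial_div_bounds {N k : ℕ} (hk : 0 < k) (hN : k ≤ N) :
    |Real.log (N / k).factorial -
      ((N : ℝ) / k * (Real.log N - Real.log k) - N / k)| ≤ Real.log (N + 1) + 1 := by
  have hk' : (1 : ℝ) ≤ k := mod_cast hk
  have hN' : (k : ℝ) ≤ N := mod_cast hN
  have hx : (1 : ℝ) ≤ (N : ℝ) / k := (one_le_div (by linarith)).mpr hN'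
  have hle : (N : ℝ) / k ≤ N := div_le_self (by linarith) hk'
  have h1 := log_factorial_floor_le hx
  have h2 := le_log_factorial_floor hx
  have h3 := Real.log_le_log (by linarith) (show (N : ℝ) / k ≤ N + 1 by linarith)
  have h4 := Real.log_le_log (by linarith) (show (N : ℝ) / k + 1 ≤ N + 1 by linarith)
  rw [Nat.floor_div_natCast, Nat.floor_natCast] at h1 h2
  rw [← Real.log_div (by linarith) (by linarith), abs_le]
  constructor <;> linarith

theorem logChebyshevQuotient_bounds {N : ℕ} (hN : 30 ≤ N) :
    0.92 * N - 5 * Real.log (N + 1) - 5 ≤ logChebyshevQuotient N ∧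
      logChebyshevQuotient N ≤ 0.922 * N + 5 * Real.log (N + 1) + 5 := by
  have h1 := abs_le.mp (log_factorial_div_bounds (k := 1) (by omega) (by omega : 1 ≤ N))
  have h2 := abs_le.mp (log_factorial_div_bounds (k := 2) (by omega) (by omega : 2 ≤ N))
  have h3 := abs_le.mp (log_factorial_div_bounds (k := 3) (by omega) (by omega : 3 ≤ N))
  have h5 := abs_le.mp (log_factorial_div_bounds (k := 5) (by omega) (by omega : 5 ≤ N))
  have h30 := abs_le.mp (log_factorial_div_bounds (k := 30) (by omega) hN)
  have hl : Real.log 30 = Real.log 2 + Real.log 3 + Real.log 5 := by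
    rw [← Real.log_mul (by norm_num) (by norm_num), ← Real.log_mul (by norm_num) (by norm_num)]
    norm_num
  push_cast at h1 h2 h3 h5 h30
  rw [hl] at h30
  simp only [Real.log_one] at h1
  set c := Real.log 2 / 2 + Real.log 3 / 3 + Real.log 5 / 5 -
    (Real.log 2 + Real.log 3 + Real.log 5) / 30 with hc
  have hc1 : 0.92 ≤ c := by
    linarith [Real.log_two_gt_d9, Real.log_three_gt_d9, Real.log_five_gt_d9]
  have hc2 : c ≤ 0.922 := by
    linarith [Real.log_two_lt_d9, Real.log_three_lt_d9, Real.log_five_lt_d9]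
  have hmul1 : 0.92 * (N : ℝ) ≤ N * c := by nlinarith [(Nat.cast_nonneg N : (0 : ℝ) ≤ N)]
  have hmul2 : N * c ≤ 0.922 * (N : ℝ) := by nlinarith [(Nat.cast_nonneg N : (0 : ℝ) ≤ N)]
  rw [hc] at hmul1 hmul2
  unfold logChebyshevQuotient
  constructor <;> linarith

theorem log_le_div_add_log_sub_one {x c : ℝ} (hx : 0 < x) (hc : 0 < c) :
    Real.log x ≤ x / c + Real.log c - 1 := by
  have h := Real.log_le_sub_one_of_pos (div_pos hx hc)
  rw [Real.log_div hx.ne' hc.ne'] at h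
  linarith

theorem log_two_pow_le (k : ℕ) : Real.log (2 ^ k) ≤ 0.6931471808 * k := by
  rw [Real.log_pow]
  nlinarith [Real.log_two_lt_d9, (Nat.cast_nonneg k : (0 : ℝ) ≤ k)]

theorem psi_le_add_const (N : ℕ) : Chebyshev.psi N ≤ 1.2 * N + 5400 := by
  induction N using Nat.strong_induction_on with
  | _ N ih =>
    rcases lt_or_ge N 1000 with hN | hN
    · have h := Chebyshev.psi_le_const_mul_self (Nat.cast_nonneg N)
      rw [Real.log_four_eq] at h
      have : (N : ℝ) ≤ 1000 := mod_cast hN.le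
      nlinarith [Real.log_two_lt_d9, (Nat.cast_nonneg N : (0 : ℝ) ≤ N)]
    · have h1 := psi_sub_psi_div_six_le N
      have h2 := (logChebyshevQuotient_bounds (by omega : 30 ≤ N)).2
      have h3 := ih (N / 6) (by omega)
      have h4 : ((N / 6 : ℕ) : ℝ) ≤ N / 6 := Nat.cast_div_le
      have hN' : (1000 : ℝ) ≤ N := mod_cast hN
      have h5 := log_le_div_add_log_sub_one (x := N + 1) (c := 2 ^ 10) (by linarith) (by norm_num)
      have h6 := log_two_pow_le 10
      push_cast at h6
      linarith

theorem le_theta {N : ℕ} (hN : 2 ^ 18 ≤ N) : 0.92 * N - 5 * Real.log (N + 1) - 5 -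
    2 * √N * Real.log N ≤ Chebyshev.theta N := by
  have h1 := (logChebyshevQuotient_bounds (by omega : 30 ≤ N)).1
  have h2 := Chebyshev.psi_sub_theta_le (x := N) (by exact_mod_cast (by omega : 1 ≤ N))
  linarith [logChebyshevQuotient_le_psi N]

theorem theta_lt_theta {a b : ℕ} (hb : 2 ^ 19 ≤ b) (hab : 1.414 * a ≤ (b + 1 : ℝ)) :
    Chebyshev.theta a < Chebyshev.theta b := by
  have h1 := le_theta (N := b) (by omega)
  have h2 := (Chebyshev.theta_le_psi a).trans (psi_le_add_const a)
  have hb' : (2 ^ 19 : ℝ) ≤ b := mod_cast hb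
  have hs : √(b : ℝ) ^ 2 = b := Real.sq_sqrt (by positivity)
  set s := √(b : ℝ) with hsdef
  have hs1 : 724 ≤ s := Real.le_sqrt_of_sq_le (by linarith)
  have h3 := log_le_div_add_log_sub_one (x := s) (c := 2 ^ 9) (by linarith) (by norm_num)
  have h4 := log_two_pow_le 9
  have h5 : Real.log b = 2 * Real.log s := by rw [← hs, Real.log_pow]; norm_num
  have h6 := log_le_div_add_log_sub_one (x := b + 1) (c := 2 ^ 19) (by linarith) (by norm_num)
  have h7 := log_two_pow_le 19
  push_cast at h4 h7
  have h8 : s * Real.log s ≤ s * (s / 512 + 5.25) := by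
    gcongr
    linarith
  rw [h5] at h1
  nlinarith

theorem exists_prime_mem_Ioc_of_theta_lt {a b : ℕ} (h : Chebyshev.theta a < Chebyshev.theta b) :
    ∃ p, p.Prime ∧ a < p ∧ p ≤ b := by
  by_contra! hno
  refine h.not_ge ?_
  rw [Chebyshev.theta, Chebyshev.theta, Nat.floor_natCast, Nat.floor_natCast]
  refine Finset.sum_le_sum_of_subset_of_nonneg (fun p hp ↦ ?_) fun p _ _ ↦
    Real.log_natCast_nonneg p
  simp only [Finset.mem_filter, Finset.mem_Ioc] at *
  have := hno p hp.2
  exact ⟨⟨hp.1.1, by omega⟩, hp.2⟩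

theorem exists_prime_sq_mem_Icc_of_large {n : ℕ} (hn : 2 ^ 38 ≤ n) :
    ∃ p, p.Prime ∧ n ≤ p ^ 2 ∧ p ^ 2 ≤ 2 * n := by
  have h1 := Nat.sqrt_le' n
  have h2 := Nat.lt_succ_sqrt' (2 * n)
  have hb : 2 ^ 19 ≤ (2 * n).sqrt := Nat.le_sqrt'.mpr (by omega)
  have h1' : ((n.sqrt : ℝ)) ^ 2 ≤ n := mod_cast h1
  have h2' : (2 * n : ℝ) < ((2 * n).sqrt + 1) ^ 2 := mod_cast h2
  have hab : 1.414 * (n.sqrt : ℝ) ≤ (2 * n).sqrt + 1 :=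
    by
    refine abs_le_of_sq_le_sq' ?_ (by positivity) |>.2
    nlinarith
  obtain ⟨p, hp, hap, hpb⟩ := exists_prime_mem_Ioc_of_theta_lt (theta_lt_theta hb hab)
  exact ⟨p, hp, (Nat.sqrt_lt'.mp hap).le, Nat.le_sqrt'.mp hpb⟩

theorem exists_prime_sq_mem_Icc_of_le_sq {n p q : ℕ} (hn : n ≤ q ^ 2) (hq : q.Prime)
    (hpq : q ^ 2 ≤ 2 * (p ^ 2 + 1))
    (h : n ≤ p ^ 2 → ∃ p, p.Prime ∧ n ≤ p ^ 2 ∧ p ^ 2 ≤ 2 * n) :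
    ∃ p, p.Prime ∧ n ≤ p ^ 2 ∧ p ^ 2 ≤ 2 * n := by
  rcases le_or_gt n (p ^ 2) with hnp | hnp
  · exact h hnp
  · exact ⟨q, hq, hn, by omega⟩

theorem exists_prime_sq_mem_Icc {n : ℕ} (hn : 61 ≤ n) :
    ∃ p, p.Prime ∧ n ≤ p ^ 2 ∧ p ^ 2 ≤ 2 * n := by
  rcases le_or_gt (2 ^ 38) n with h | h
  · exact exists_prime_sq_mem_Icc_of_large h
  replace h : n ≤ 569497 ^ 2 := by omega
  refine exists_prime_sq_mem_Icc_of_le_sq (p := 402697) h (by norm_num) (by norm_num) fun h ↦ ?_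
  refine exists_prime_sq_mem_Icc_of_le_sq (p := 284759) h (by norm_num) (by norm_num) fun h ↦ ?_
  refine exists_prime_sq_mem_Icc_of_le_sq (p := 201359) h (by norm_num) (by norm_num) fun h ↦ ?_
  refine exists_prime_sq_mem_Icc_of_le_sq (p := 142403) h (by norm_num) (by norm_num) fun h ↦ ?_
  refine exists_prime_sq_mem_Icc_of_le_sq (p := 100703) h (by norm_num) (by norm_num) fun h ↦ ?_
  refine exists_prime_sq_mem_Icc_of_le_sq (p := 71209) h (by norm_num) (by norm_num) fun h ↦ ?_
  refine exists_prime_sq_mem_Icc_of_le_sq (p := 50363) h (by norm_num) (by norm_num) fun h ↦ ?_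
  refine exists_prime_sq_mem_Icc_of_le_sq (p := 35617) h (by norm_num) (by norm_num) fun h ↦ ?_
  refine exists_prime_sq_mem_Icc_of_le_sq (p := 25219) h (by norm_num) (by norm_num) fun h ↦ ?_
  refine exists_prime_sq_mem_Icc_of_le_sq (p := 17839) h (by norm_num) (by norm_num) fun h ↦ ?_
  refine exists_prime_sq_mem_Icc_of_le_sq (p := 12619) h (by norm_num) (by norm_num) fun h ↦ ?_
  refine exists_prime_sq_mem_Icc_of_le_sq (p := 8923) h (by norm_num) (by norm_num) fun h ↦ ?_
  refine exists_prime_sq_mem_Icc_of_le_sq (p := 6311) h (by norm_num) (by norm_num) fun h ↦ ?_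
  refine exists_prime_sq_mem_Icc_of_le_sq (p := 4463) h (by norm_num) (by norm_num) fun h ↦ ?_
  refine exists_prime_sq_mem_Icc_of_le_sq (p := 3163) h (by norm_num) (by norm_num) fun h ↦ ?_
  refine exists_prime_sq_mem_Icc_of_le_sq (p := 2237) h (by norm_num) (by norm_num) fun h ↦ ?_
  refine exists_prime_sq_mem_Icc_of_le_sq (p := 1583) h (by norm_num) (by norm_num) fun h ↦ ?_
  refine exists_prime_sq_mem_Icc_of_le_sq (p := 1129) h (by norm_num) (by norm_num) fun h ↦ ?_
  refine exists_prime_sq_mem_Icc_of_le_sq (p := 811) h (by norm_num) (by norm_num) fun h ↦ ?_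
  refine exists_prime_sq_mem_Icc_of_le_sq (p := 577) h (by norm_num) (by norm_num) fun h ↦ ?_
  refine exists_prime_sq_mem_Icc_of_le_sq (p := 409) h (by norm_num) (by norm_num) fun h ↦ ?_
  refine exists_prime_sq_mem_Icc_of_le_sq (p := 293) h (by norm_num) (by norm_num) fun h ↦ ?_
  refine exists_prime_sq_mem_Icc_of_le_sq (p := 211) h (by norm_num) (by norm_num) fun h ↦ ?_
  refine exists_prime_sq_mem_Icc_of_le_sq (p := 157) h (by norm_num) (by norm_num) fun h ↦ ?_
  refine exists_prime_sq_mem_Icc_of_le_sq (p := 113) h (by norm_num) (by norm_num) fun h ↦ ?_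
  refine exists_prime_sq_mem_Icc_of_le_sq (p := 83) h (by norm_num) (by norm_num) fun h ↦ ?_
  refine exists_prime_sq_mem_Icc_of_le_sq (p := 59) h (by norm_num) (by norm_num) fun h ↦ ?_
  refine exists_prime_sq_mem_Icc_of_le_sq (p := 43) h (by norm_num) (by norm_num) fun h ↦ ?_
  refine exists_prime_sq_mem_Icc_of_le_sq (p := 31) h (by norm_num) (by norm_num) fun h ↦ ?_
  refine exists_prime_sq_mem_Icc_of_le_sq (p := 23) h (by norm_num) (by norm_num) fun h ↦ ?_
  refine exists_prime_sq_mem_Icc_of_le_sq (p := 17) h (by norm_num) (by norm_num) fun h ↦ ?_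
  refine exists_prime_sq_mem_Icc_of_le_sq (p := 13) h (by norm_num) (by norm_num) fun h ↦ ?_
  refine exists_prime_sq_mem_Icc_of_le_sq (p := 11) h (by norm_num) (by norm_num) fun h ↦ ?_
  exact ⟨11, by norm_num, h, by omega⟩

theorem exists_add_eq_of_sq_mem_Icc {n p : ℕ} (hp : Odd p) (hnp : n ≤ p ^ 2)
    (hpn : p ^ 2 ≤ 2 * n) :
    ∃ x y z w : ℕ, n = x ^ 2 + y ^ 2 + z ^ 2 + 2 * w ^ 2 ∧ x + y = p := by
  have hp2 : Odd (p ^ 2) := hp.pow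
  obtain ⟨d, z, w, h⟩ := exists_sq_add_two_mul_sq_add_four_mul_sq (m := 2 * n - p ^ 2)
    (Nat.Even.sub_odd hpn (even_two_mul n) hp2)
  have h' : 2 * n = p ^ 2 + d.natAbs ^ 2 + 2 * z.natAbs ^ 2 + 4 * w.natAbs ^ 2 := by
    zify [hpn] at h ⊢
    simp only [sq_abs]
    linarith
  have hdp : d.natAbs ≤ p := by
    refine (Nat.pow_le_pow_iff_left two_ne_zero).mp ?_
    omega
  have hd : Odd (d.natAbs ^ 2) := by
    rw [Nat.odd_iff] at *
    omega
  rw [Nat.odd_pow_iff two_ne_zero] at hd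
  obtain ⟨y, hy⟩ : ∃ y, p = d.natAbs + 2 * y := by
    rw [Nat.odd_iff] at *
    exact ⟨(p - d.natAbs) / 2, by omega⟩
  refine ⟨d.natAbs + y, y, z.natAbs, w.natAbs, ?_, by omega⟩
  rw [hy] at h'
  nlinarith

theorem sums_of_squares_x_plus_y_prime (n : ℕ) (hn : 1 < n) :
    ∃ x y z w p : ℕ, Nat.Prime p ∧
      n = x ^ 2 + y ^ 2 + z ^ 2 + 2 * w ^ 2 ∧ x + y = p := by
  by_cases! h : ∃ p, p.Prime ∧ Odd p ∧ n ≤ p ^ 2 ∧ p ^ 2 ≤ 2 * n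
  · obtain ⟨p, hp, hodd, hnp, hpn⟩ := h
    obtain ⟨x, y, z, w, hxyzw, hxy⟩ := exists_add_eq_of_sq_mem_Icc hodd hnp hpn
    exact ⟨x, y, z, w, p, hp, hxyzw, hxy⟩
  have hn61 : n < 61 := by
    by_contra! hn61
    obtain ⟨p, hp, hnp, hpn⟩ := exists_prime_sq_mem_Icc hn61
    exact (h p hp (hp.odd_of_ne_two (by rintro rfl; omega)) hnp).not_ge hpn
  have h3 := h 3 (by norm_num) (by decide)
  have h5 := h 5 (by norm_num) (by decide)
  have h7 := h 7 (by norm_num) (by decide)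
  obtain hn | hn | hn : n ≤ 4 ∨ (10 ≤ n ∧ n ≤ 12) ∨ 50 ≤ n := by omega
  · interval_cases n
    · exact ⟨1, 1, 0, 0, _, by norm_num, rfl, rfl⟩
    · exact ⟨1, 1, 1, 0, _, by norm_num, rfl, rfl⟩
    · exact ⟨0, 2, 0, 0, _, by norm_num, rfl, rfl⟩
  · obtain ⟨hn1, hn2⟩ := hn
    interval_cases n
    · exact ⟨0, 2, 2, 1, _, by norm_num, rfl, rfl⟩
    · exact ⟨0, 3, 0, 1, _, by norm_num, rfl, rfl⟩
    · exact ⟨0, 2, 0, 2, _, by norm_num, rfl, rfl⟩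
  · interval_cases n
    · exact ⟨0, 3, 3, 4, _, by norm_num, rfl, rfl⟩
    · exact ⟨0, 7, 0, 1, _, by norm_num, rfl, rfl⟩
    · exact ⟨0, 2, 4, 4, _, by norm_num, rfl, rfl⟩
    · exact ⟨0, 2, 7, 0, _, by norm_num, rfl, rfl⟩
    · exact ⟨0, 2, 0, 5, _, by norm_num, rfl, rfl⟩
    · exact ⟨0, 2, 1, 5, _, by norm_num, rfl, rfl⟩
    · exact ⟨1, 1, 2, 5, _, by norm_num, rfl, rfl⟩
    · exact ⟨0, 3, 4, 4, _, by norm_num, rfl, rfl⟩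
    · exact ⟨0, 2, 2, 5, _, by norm_num, rfl, rfl⟩
    · exact ⟨0, 3, 0, 5, _, by norm_num, rfl, rfl⟩
    · exact ⟨0, 3, 1, 5, _, by norm_num, rfl, rfl⟩
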